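/- arXiv:1712.07761 — 6 statements merged into one kernel-verified Lean document; each statement's English description precedes it below -/
import Mathlib

section
/- Assume (a) the ordering condition: for almost every t ∈ Ω and every j ∈ J, 0 ≤ u⋆_j(t) ≤ u⋆τ_j(t) and u⋆τ_j(t) > 0, with (u⋆τ_j − u⋆_j)/u⋆τ_j integrable on Ω; (b) the convexity inequality F(u⋆) ≥ F(u⋆τ) − T(u⋆τ − u⋆); (c) the first-order (barrier) optimality condition T(u⋆τ − u⋆) = τ·Σ_{j∈J} ∫_Ω (u⋆τ_j(t) − u⋆_j(t))/u⋆τ_j(t) dt; and (d) the quadratic growth condition F(u⋆τ) ≥ F(u⋆) + c·‖u⋆τ − u⋆‖². Then the barrier solution converges to the constrained solution at rate ‖u⋆τ − u⋆‖ ≤ √(τ·|J|·(tE − t0)/c), where |J| is the cardinality of J. -/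
open MeasureTheory

/-- convergence of barrier solutions.
On `Ω = (t0, tE)` with Lebesgue measure, with components indexed by `J ⊆ Fin n`,
under (a) ordering `0 ≤ u⋆ⱼ ≤ u⋆τⱼ`, `u⋆τⱼ > 0` a.e. with integrable quotients,
(b) convexity `F u⋆ ≥ F u⋆τ − T(u⋆τ − u⋆)`,
(c) barrier optimality `T(u⋆τ − u⋆) = τ Σⱼ∈J ∫ (u⋆τⱼ − u⋆ⱼ)/u⋆τⱼ`,
(d) quadratic growth `F u⋆τ ≥ F u⋆ + c‖u⋆τ − u⋆‖²`,
then `‖u⋆τ − u⋆‖ ≤ √(τ |J| (tE − t0)/c)`. -/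
theorem barrier_convergence
    (t0 tE : ℝ) (ht : t0 < tE)
    (n : ℕ) (J : Finset (Fin n))
    (ustar utau : ℝ → Fin n → ℝ)
    (F : (ℝ → Fin n → ℝ) → ℝ)
    (T : (ℝ → Fin n → ℝ) →ₗ[ℝ] ℝ)
    (τ c : ℝ) (hτ : 0 < τ) (hc : 0 < c)
    -- (a) ordering condition
    (ha : ∀ᵐ t ∂(volume.restrict (Set.Ioo t0 tE)), ∀ j ∈ J,
      0 ≤ ustar t j ∧ ustar t j ≤ utau t j ∧ 0 < utau t j)
    (ha' : ∀ j ∈ J, IntegrableOn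
      (fun t => (utau t j - ustar t j) / utau t j) (Set.Ioo t0 tE))
    -- (b) convexity inequality
    (hb : F ustar ≥ F utau - T (utau - ustar))
    -- (c) first-order (barrier) optimality condition
    (hcnd : T (utau - ustar) =
      τ * ∑ j ∈ J, ∫ t in Set.Ioo t0 tE, (utau t j - ustar t j) / utau t j)
    -- (d) quadratic growth condition
    (hd : F utau ≥ F ustar +
      c * (∑ j : Fin n, ∫ t in Set.Ioo t0 tE, (utau t j - ustar t j) ^ 2)) :
    Real.sqrt (∑ j : Fin n, ∫ t in Set.Ioo t0 tE, (utau t j - ustar t j) ^ 2)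
      ≤ Real.sqrt (τ * J.card * (tE - t0) / c) := by
  have hint : ∀ j ∈ J, ∫ t in Set.Ioo t0 tE, (utau t j - ustar t j) / utau t j ≤ tE - t0 := by
    intro j hj
    have h1 : ∫ t in Set.Ioo t0 tE, (utau t j - ustar t j) / utau t j
        ≤ ∫ _t in Set.Ioo t0 tE, (1 : ℝ) := by
      refine integral_mono_ae (ha' j hj) (integrable_const _) ?_
      filter_upwards [ha] with t h
      obtain ⟨h0, -, h2⟩ := h j hj
      show (utau t j - ustar t j) / utau t j ≤ 1
      rw [div_le_one h2]
      linarith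
    have h2 : ∫ _t in Set.Ioo t0 tE, (1 : ℝ) = tE - t0 := by
      simp [ht.le]
    linarith
  have hsum : ∑ j ∈ J, ∫ t in Set.Ioo t0 tE, (utau t j - ustar t j) / utau t j
      ≤ J.card * (tE - t0) := by
    have h := Finset.sum_le_card_nsmul J _ _ hint
    rwa [nsmul_eq_mul] at h
  have hmul := mul_le_mul_of_nonneg_left hsum hτ.le
  apply Real.sqrt_le_sqrt
  rw [le_div_iff₀ hc]
  linarith
end

section
/- Assume (a) the ordering condition: for almost every t ∈ Ω and every j ∈ J, 0 ≤ u⋆_j(t) ≤ u⋆τ_j(t) and u⋆τ_j(t) > 0, with (u⋆τ_j − u⋆_j)/u⋆τ_j integrable on Ω; (b) the convexity inequality F(u⋆) ≥ F(u⋆τ) − T(u⋆τ − u⋆); and (c) the first-order (barrier) optimality condition T(u⋆τ − u⋆) = τ·Σ_{j∈J} ∫_Ω (u⋆τ_j(t) − u⋆_j(t))/u⋆τ_j(t) dt. Then the objective value of the barrier solution satisfies F(u⋆τ) ≤ F(u⋆) + τ·|J|·(tE − t0), where |J| is the cardinality of J. -/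
open MeasureTheory

/-- objective-value bound for barrier solutions.
On `Ω = (t0, tE)` with Lebesgue measure, with components indexed by `J ⊆ Fin n`,
under (a) ordering `0 ≤ u⋆ⱼ ≤ u⋆τⱼ`, `u⋆τⱼ > 0` a.e. with integrable quotients,
(b) convexity `F u⋆ ≥ F u⋆τ − T(u⋆τ − u⋆)`, and
(c) barrier optimality `T(u⋆τ − u⋆) = τ Σⱼ∈J ∫ (u⋆τⱼ − u⋆ⱼ)/u⋆τⱼ`,
then `F u⋆τ ≤ F u⋆ + τ |J| (tE − t0)`. -/
theorem barrier_objective_bound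
    (t0 tE : ℝ) (ht : t0 < tE)
    (n : ℕ) (J : Finset (Fin n))
    (ustar utau : ℝ → Fin n → ℝ)
    (F : (ℝ → Fin n → ℝ) → ℝ)
    (T : (ℝ → Fin n → ℝ) →ₗ[ℝ] ℝ)
    (τ : ℝ) (hτ : 0 < τ)
    -- (a) ordering condition
    (ha : ∀ᵐ t ∂(volume.restrict (Set.Ioo t0 tE)), ∀ j ∈ J,
      0 ≤ ustar t j ∧ ustar t j ≤ utau t j ∧ 0 < utau t j)
    (ha' : ∀ j ∈ J, IntegrableOn
      (fun t => (utau t j - ustar t j) / utau t j) (Set.Ioo t0 tE))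
    -- (b) convexity inequality
    (hb : F ustar ≥ F utau - T (utau - ustar))
    -- (c) first-order (barrier) optimality condition
    (hcnd : T (utau - ustar) =
      τ * ∑ j ∈ J, ∫ t in Set.Ioo t0 tE, (utau t j - ustar t j) / utau t j) :
    F utau ≤ F ustar + τ * J.card * (tE - t0) := by
  have h1 : ∀ j ∈ J, ∫ t in Set.Ioo t0 tE, (utau t j - ustar t j) / utau t j ≤ tE - t0 := by
    intro j hj
    have hc : ∫ _ in Set.Ioo t0 tE, (1 : ℝ) = tE - t0 := by
      simp [ht.le]
    rw [← hc]
    refine integral_mono_ae (ha' j hj) (integrable_const _) ?_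
    filter_upwards [ha] with t h
    obtain ⟨h0, _, h2⟩ := h j hj
    show (utau t j - ustar t j) / utau t j ≤ 1
    rw [div_le_one h2]
    linarith
  have h2 := Finset.sum_le_card_nsmul J _ _ h1
  rw [nsmul_eq_mul] at h2
  have h3 := mul_le_mul_of_nonneg_left h2 hτ.le
  rw [← hcnd, ← mul_assoc] at h3
  linarith
end

section
/- Let d ∈ ℕ and let p : ℝ → ℝ be a polynomial of degree at most d. Then the supremum of |p| over the unit interval is controlled by its L² norm there: sup_{t ∈ [0,1]} |p(t)| ≤ (d+1) · (∫_0^1 p(t)² dt)^{1/2}. -/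
open Polynomial in
lemma kernel_exists (d : ℕ) : ∃ q : ℝ[X], q.natDegree ≤ d ∧ q.eval 0 = ((d:ℝ)+1)^2 ∧
    ∀ p : ℝ[X], p.natDegree ≤ d → ∫ t in (0:ℝ)..1, q.eval t * p.eval t = p.eval 0 := by
  set f : ℝ[X] := ∏ i ∈ Finset.range d, (X - C ((i:ℝ)+1)) with hf
  set s := Finset.range (d+1) with hs
  set v : ℕ → ℝ := fun j => -((j:ℝ)+1) with hv
  have hinj : Set.InjOn v s := by
    intro a _ b _ h
    simpa [hv] using h
  have hfd : f.degree < s.card := by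
    rw [hf, degree_prod, Finset.sum_congr rfl (fun (i : ℕ) _ => degree_X_sub_C ((i:ℝ)+1))]
    simp [hs]
    exact_mod_cast Nat.lt_succ_self d
  have hinterp := Lagrange.eq_interpolate (f := f) hinj hfd
  set w : ℕ → ℝ := fun j => Lagrange.nodalWeight s v j * f.eval (v j) with hw
  have hnod : ∀ k : ℕ, (Lagrange.nodal s v).eval (k:ℝ) ≠ 0 := by
    intro k
    rw [Lagrange.eval_nodal, Finset.prod_ne_zero_iff]
    intro j _
    simp only [hv, sub_neg_eq_add]
    positivity
  have hsum : ∀ k : ℕ, f.eval (k:ℝ) = (Lagrange.nodal s v).eval (k:ℝ) *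
      ∑ j ∈ s, w j * ((k:ℝ)+j+1)⁻¹ := by
    intro k
    conv_lhs => rw [hinterp]
    rw [Lagrange.eval_interpolate_not_at_node]
    · congr 1
      apply Finset.sum_congr rfl
      intro j _
      simp only [hw, hv]
      rw [show (k:ℝ) - -((j:ℝ)+1) = k+j+1 by ring]
      ring
    · intro j _
      simp only [hv]
      have : (0:ℝ) < (k:ℝ) + (j + 1) := by positivity
      intro h
      linarith
  have hz : ∀ k : ℕ, 1 ≤ k → k ≤ d → ∑ j ∈ s, w j * ((k:ℝ)+j+1)⁻¹ = 0 := by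
    intro k h1 h2
    have h := hsum k
    have : f.eval (k:ℝ) = 0 := by
      rw [hf, eval_prod, Finset.prod_eq_zero_iff]
      refine ⟨k-1, by simp; omega, ?_⟩
      simp [Nat.cast_sub h1]
    rw [this] at h
    exact (mul_eq_zero.mp h.symm).resolve_left (hnod k)
  have hp : ∏ i ∈ Finset.range d, ((i:ℝ)+1) = (d.factorial : ℝ) := by
    rw [← Finset.prod_range_add_one_eq_factorial]; push_cast; rfl
  have hp' : ∏ i ∈ Finset.range (d+1), ((i:ℝ)+1) = (d+1) * (d.factorial : ℝ) := by
    rw [Finset.prod_range_succ, hp]; ring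
  have hd0 : (d.factorial : ℝ) ≠ 0 := by exact_mod_cast d.factorial_ne_zero
  have hd1 : (d:ℝ)+1 ≠ 0 := by positivity
  have h0 : ∑ j ∈ s, w j * (((0:ℕ):ℝ)+j+1)⁻¹ = (-1)^d / (d+1) := by
    have h := hsum 0
    have e1 : f.eval ((0:ℕ):ℝ) = (-1)^d * d.factorial := by
      rw [hf, eval_prod, ← hp]
      simp only [eval_sub, eval_X, eval_C, Nat.cast_zero, zero_sub]
      rw [Finset.prod_neg]; simp
    have e2 : (Lagrange.nodal s v).eval ((0:ℕ):ℝ) = (d+1) * d.factorial := by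
      rw [Lagrange.eval_nodal, ← hp']
      simp [hv, hs]
    rw [e1, e2] at h
    rw [eq_div_iff hd1]
    apply mul_left_cancel₀ hd0
    linarith
  have hw0 : w 0 = (-1)^d * (d+1) := by
    have e1 : f.eval (v 0) = (-1)^d * ((d+1) * d.factorial) := by
      rw [hf, eval_prod, ← hp', Finset.prod_range_succ']
      simp only [eval_sub, eval_X, eval_C, hv]
      rw [Finset.prod_congr rfl (g := fun i : ℕ => -(((i+1:ℕ):ℝ)+1)) (by intros; push_cast; ring), Finset.prod_neg]; simp
    have e2 : Lagrange.nodalWeight s v 0 = (d.factorial:ℝ)⁻¹ := by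
      have : s.erase 0 = (Finset.range d).map ⟨fun i => i+1, add_left_injective 1⟩ := by
        ext j; simp [hs]; constructor
        · rintro ⟨a, b⟩; exact ⟨j-1, by omega, by omega⟩
        · rintro ⟨a, b, rfl⟩; omega
      rw [Lagrange.nodalWeight, this, Finset.prod_map, ← hp, ← Finset.prod_inv_distrib]
      apply Finset.prod_congr rfl
      intro i _
      simp [hv]
    simp only [hw]
    rw [e1, e2]; field_simp
  have hsq : ((-1:ℝ)^d) * (-1)^d = 1 := by rw [← mul_pow]; simp
  refine ⟨∑ j ∈ s, C ((-1)^d * (d+1) * w j) * X^j, ?_, ?_, ?_⟩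
  · apply natDegree_sum_le_of_forall_le
    intro j hj
    refine (natDegree_C_mul_X_pow_le _ _).trans ?_
    simp [hs] at hj; omega
  · rw [eval_finsetSum, Finset.sum_eq_single 0]
    · simp only [eval_mul, eval_C, eval_pow, eval_X, pow_zero, mul_one, hw0]
      linear_combination ((d:ℝ)+1)^2 * hsq
    · intro j _ hj; simp [hj]
    · simp [hs]
  · intro p hpd
    have hmono : ∀ k : ℕ, ∫ t in (0:ℝ)..1, (∑ j ∈ s, C ((-1)^d * (d+1) * w j) * X^j : ℝ[X]).eval t * t^k
        = (-1)^d * (d+1) * ∑ j ∈ s, w j * ((k:ℝ)+j+1)⁻¹ := by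
      intro k
      simp only [eval_finsetSum, eval_mul, eval_C, eval_pow, eval_X, Finset.sum_mul]
      rw [intervalIntegral.integral_finsetSum]
      · rw [Finset.mul_sum]
        apply Finset.sum_congr rfl
        intro j _
        simp only [mul_assoc, ← pow_add, intervalIntegral.integral_const_mul, integral_pow]
        push_cast
        simp [add_comm, add_left_comm]
      · intro j _
        exact Continuous.intervalIntegrable (by fun_prop) _ _
    set q : ℝ[X] := ∑ j ∈ s, C ((-1)^d * (d+1) * w j) * X^j with hq
    have : ∀ t : ℝ, q.eval t * p.eval t = ∑ k ∈ Finset.range (d+1), p.coeff k * (q.eval t * t^k) := by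
      intro t
      rw [eval_eq_sum_range' (Nat.lt_succ_of_le hpd), Finset.mul_sum]
      apply Finset.sum_congr rfl
      intros; ring
    simp only [this]
    rw [intervalIntegral.integral_finsetSum]
    · simp only [intervalIntegral.integral_const_mul, hmono]
      rw [Finset.sum_eq_single 0, h0, ← coeff_zero_eq_eval_zero]
      · field_simp
        linear_combination p.coeff 0 * hsq
      · intro k hk hk0
        rw [hz k (by omega) (by simp at hk; omega)]; simp
      · simp
    · intro j _
      exact Continuous.intervalIntegrable (by fun_prop) _ _

open Polynomial in
lemma endpoint_bound (d : ℕ) (p : ℝ[X]) (hp : p.natDegree ≤ d) :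
    (p.eval 0)^2 ≤ ((d:ℝ)+1)^2 * ∫ t in (0:ℝ)..1, (p.eval t)^2 := by
  obtain ⟨q, hqd, hq0, hq⟩ := kernel_exists d
  have h1 := hq p hp
  have h2 := hq q hqd
  set N : ℝ := ((d:ℝ)+1)^2 with hN
  have hNpos : 0 < N := by positivity
  have h3 : 0 ≤ ∫ t in (0:ℝ)..1, (N * p.eval t - p.eval 0 * q.eval t)^2 :=
    intervalIntegral.integral_nonneg (by norm_num) (fun _ _ => sq_nonneg _)
  have h4 : ∫ t in (0:ℝ)..1, (N * p.eval t - p.eval 0 * q.eval t)^2 =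
      N^2 * (∫ t in (0:ℝ)..1, (p.eval t)^2) - 2 * N * p.eval 0 * (∫ t in (0:ℝ)..1, q.eval t * p.eval t)
        + (p.eval 0)^2 * ∫ t in (0:ℝ)..1, q.eval t * q.eval t := by
    rw [← intervalIntegral.integral_const_mul, ← intervalIntegral.integral_const_mul,
      ← intervalIntegral.integral_const_mul, ← intervalIntegral.integral_sub,
      ← intervalIntegral.integral_add]
    · congr 1; ext t; ring
    all_goals exact Continuous.intervalIntegrable (by fun_prop) _ _
  rw [h4, h1, h2, hq0] at h3
  have : 0 ≤ N * (N * (∫ t in (0:ℝ)..1, (p.eval t)^2) - (p.eval 0)^2) := by linarith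
  have := nonneg_of_mul_nonneg_right this hNpos
  linarith

open Polynomial in
lemma endpoint_scaled (d : ℕ) (p : ℝ[X]) (hp : p.natDegree ≤ d) (t c : ℝ) :
    (p.eval t)^2 ≤ ((d:ℝ)+1)^2 * ∫ x in (0:ℝ)..1, (p.eval (t + c * x))^2 := by
  have h := endpoint_bound d (p.comp (C t + C c * X)) (by
    refine natDegree_comp_le.trans ?_
    have : (C t + C c * X : ℝ[X]).natDegree ≤ 1 := by compute_degree
    nlinarith)
  simpa using h

/-- inverse (norm-equivalence) inequality for polynomials on the
unit interval: if `p` has degree at most `d`, then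
`sup_{t∈[0,1]} |p(t)| ≤ (d+1)·(∫_0^1 p(t)² dt)^{1/2}`. -/
theorem polynomial_sup_le_L2_unit_interval
    (d : ℕ) (p : Polynomial ℝ) (hdeg : p.natDegree ≤ d) :
    (⨆ t ∈ Set.Icc (0:ℝ) 1, |p.eval t|) ≤
      (d + 1) * Real.sqrt (∫ t in (0:ℝ)..1, (p.eval t) ^ 2) := by
  have hR : 0 ≤ ((d:ℝ) + 1) * Real.sqrt (∫ t in (0:ℝ)..1, (p.eval t) ^ 2) := by positivity
  refine Real.iSup_le (fun t => Real.iSup_le (fun ht => ?_) hR) hR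
  have e1 := endpoint_scaled d p hdeg t (-t)
  have e2 := endpoint_scaled d p hdeg t (1-t)
  have i1 := intervalIntegral.mul_integral_comp_add_mul (a := 0) (b := 1) (f := fun x => (p.eval x)^2) (c := -t) (d := t)
  have i2 := intervalIntegral.mul_integral_comp_add_mul (a := 0) (b := 1) (f := fun x => (p.eval x)^2) (c := 1-t) (d := t)
  have ii : ∀ a b : ℝ, IntervalIntegrable (fun x => (p.eval x)^2) MeasureTheory.volume a b :=
    fun a b => Continuous.intervalIntegrable (by fun_prop) _ _
  have i3 := intervalIntegral.integral_add_adjacent_intervals (ii 0 t) (ii t 1)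
  simp only [mul_zero, add_zero, mul_one, add_neg_cancel, add_sub_cancel] at i1 i2
  rw [intervalIntegral.integral_symm 0 t] at i1
  have m1 := mul_le_mul_of_nonneg_left e1 ht.1
  have m2 := mul_le_mul_of_nonneg_left e2 (sub_nonneg.mpr ht.2)
  have key : (p.eval t)^2 ≤ ((d:ℝ)+1)^2 * ∫ x in (0:ℝ)..1, (p.eval x)^2 := by
    rw [← i3]
    linear_combination m1 + m2 - ((d:ℝ)+1)^2 * i1 + ((d:ℝ)+1)^2 * i2
  calc |p.eval t| ≤ Real.sqrt (((d:ℝ)+1)^2 * ∫ x in (0:ℝ)..1, (p.eval x)^2) := Real.abs_le_sqrt key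
    _ = _ := by rw [Real.sqrt_mul (by positivity), Real.sqrt_sq (by positivity)]
end

section
/- Let d ∈ ℕ, let a < b be real numbers, and let p : ℝ → ℝ be a polynomial of degree at most d. Then sup_{t ∈ [a,b]} |p(t)| ≤ ((d+1)/√(b−a)) · (∫_a^b p(t)² dt)^{1/2}. -/
open Polynomial in
theorem exists_coeffs (d : ℕ) : ∃ c : ℕ → ℝ, c 0 = ((d : ℝ) + 1) ^ 2 ∧
    ∀ j ≤ d, ∑ i ∈ Finset.range (d + 1), c i / ((i : ℝ) + j + 1) = if j = 0 then 1 else 0 := by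
  let v : ℕ → ℝ := fun i => -((i : ℝ) + 1)
  let N : ℝ[X] := C ((d : ℝ) + 1) * ∏ k ∈ Finset.range d, (C ((k : ℝ) + 1) - X)
  have hN : ∀ s : ℝ, N.eval s = ((d : ℝ) + 1) * ∏ k ∈ Finset.range d, ((k : ℝ) + 1 - s) := by
    intro s
    simp [N, eval_prod]
  have hv : Set.InjOn v (Finset.range (d + 1)) := by
    intro i _ j _ h
    have h' : -((i : ℝ) + 1) = -((j : ℝ) + 1) := h
    have : (i : ℝ) = j := by linarith
    exact_mod_cast this
  have hdegN : N.degree < ((Finset.range (d + 1)).card : WithBot ℕ) := by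
    rw [Finset.card_range]
    refine lt_of_le_of_lt (degree_le_natDegree) ?_
    have h1 : N.natDegree ≤ d := by
      refine (natDegree_C_mul_le _ _).trans ((natDegree_prod_le _ _).trans ?_)
      refine (Finset.sum_le_sum (g := fun _ => 1) ?_).trans (by simp)
      intro k _
      refine (natDegree_sub_le _ _).trans ?_
      rw [natDegree_C, natDegree_X]
      simp
    exact_mod_cast Nat.lt_succ_of_le h1
  have hint := Lagrange.eq_interpolate hv hdegN
  have hfac : (∏ k ∈ Finset.range d, ((k : ℝ) + 1)) = (d.factorial : ℝ) := by
    rw [← Finset.prod_range_add_one_eq_factorial]; push_cast; rfl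
  refine ⟨fun i => Lagrange.nodalWeight (Finset.range (d + 1)) v i * N.eval (v i), ?_, ?_⟩
  · have hw : Lagrange.nodalWeight (Finset.range (d + 1)) v 0 = ((d.factorial : ℝ))⁻¹ := by
      rw [Lagrange.nodalWeight, ← hfac, ← Finset.prod_inv_distrib]
      have : (Finset.range (d + 1)).erase 0 = (Finset.range d).image (· + 1) := by
        ext x
        simp only [Finset.mem_erase, Finset.mem_range, Finset.mem_image]
        constructor
        · rintro ⟨h1, h2⟩; exact ⟨x - 1, by omega, by omega⟩
        · rintro ⟨y, h1, rfl⟩; omega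
      rw [this, Finset.prod_image (by intro a _ b _ h; simpa using h)]
      refine Finset.prod_congr rfl fun k _ => ?_
      simp [v]
    have h2 : N.eval (v 0) = ((d : ℝ) + 1) * ((d + 1).factorial : ℝ) := by
      rw [hN, ← Finset.prod_range_add_one_eq_factorial, Finset.prod_range_succ']
      push_cast
      simp only [v]
      congr 1
      simp
    show Lagrange.nodalWeight (Finset.range (d + 1)) v 0 * N.eval (v 0) = _
    rw [hw, h2, Nat.factorial_succ]
    have : (d.factorial : ℝ) ≠ 0 := by positivity
    push_cast
    field_simp
  · intro j hj
    have hne : ∀ i ∈ Finset.range (d + 1), (j : ℝ) ≠ v i := by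
      intro i _
      have : (0 : ℝ) < j + (i + 1) := by positivity
      intro h
      simp only [v] at h
      linarith
    have h1 := Lagrange.eval_interpolate_not_at_node (fun i => N.eval (v i)) hne
    rw [← hint] at h1
    have h2 : ∑ i ∈ Finset.range (d + 1),
        Lagrange.nodalWeight (Finset.range (d + 1)) v i * N.eval (v i) / ((i : ℝ) + j + 1)
        = ∑ i ∈ Finset.range (d + 1), Lagrange.nodalWeight (Finset.range (d + 1)) v i *
          ((j : ℝ) - v i)⁻¹ * N.eval (v i) := by
      refine Finset.sum_congr rfl fun i _ => ?_
      have : (j : ℝ) - v i = (i : ℝ) + j + 1 := by simp only [v]; ring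
      rw [this]; ring
    rw [h2]
    have hnod : eval (j : ℝ) (Lagrange.nodal (Finset.range (d + 1)) v) ≠ 0 := by
      rw [Lagrange.eval_nodal]
      exact Finset.prod_ne_zero_iff.mpr fun i hi => sub_ne_zero.mpr (hne i hi)
    split_ifs with h0
    · subst h0
      have h3 : eval ((0 : ℕ) : ℝ) (Lagrange.nodal (Finset.range (d + 1)) v)
          = ((d + 1).factorial : ℝ) := by
        rw [Lagrange.eval_nodal, ← Finset.prod_range_add_one_eq_factorial]
        push_cast
        exact Finset.prod_congr rfl fun k _ => by simp only [v]; ring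
      have h4 : N.eval ((0 : ℕ) : ℝ) = ((d + 1).factorial : ℝ) := by
        rw [hN]
        simp only [Nat.cast_zero, sub_zero]
        rw [hfac, Nat.factorial_succ]; push_cast; ring
      rw [h4] at h1
      rw [h3] at h1 hnod
      exact mul_left_cancel₀ hnod (by rw [← h1]; ring)
    · have h4 : N.eval (j : ℝ) = 0 := by
        rw [hN]
        have : ∏ k ∈ Finset.range d, ((k : ℝ) + 1 - j) = 0 := by
          refine Finset.prod_eq_zero (i := j - 1) (by simp; omega) ?_
          have : ((j - 1 : ℕ) : ℝ) + 1 = j := by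
            exact_mod_cast (by omega : j - 1 + 1 = j)
          rw [this]; ring
        rw [this]; ring
      rw [h4] at h1
      exact (mul_eq_zero.mp h1.symm).resolve_left hnod

open Polynomial in
theorem exists_kernel (d : ℕ) : ∃ K : ℝ[X], K.natDegree ≤ d ∧ K.eval 0 = ((d : ℝ) + 1) ^ 2 ∧
    ∀ p : ℝ[X], p.natDegree ≤ d → ∫ x in (0 : ℝ)..1, p.eval x * K.eval x = p.eval 0 := by
  obtain ⟨c, hc0, hc⟩ := exists_coeffs d
  refine ⟨∑ i ∈ Finset.range (d + 1), C (c i) * X ^ i, ?_, ?_, ?_⟩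
  · refine natDegree_sum_le_of_forall_le _ _ fun i hi => ?_
    refine (natDegree_C_mul_X_pow_le _ _).trans ?_
    have := Finset.mem_range.mp hi
    omega
  · rw [eval_finsetSum, Finset.sum_range_succ']
    simp [hc0]
  · intro p hp
    have hp' : ∀ x : ℝ, p.eval x = ∑ j ∈ Finset.range (d + 1), p.coeff j * x ^ j :=
      fun x => eval_eq_sum_range' (by omega) x
    have e : ∀ x : ℝ, p.eval x * (∑ i ∈ Finset.range (d + 1), C (c i) * X ^ i).eval x =
        ∑ j ∈ Finset.range (d + 1), ∑ i ∈ Finset.range (d + 1),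
          (p.coeff j * c i) * x ^ (i + j) := by
      intro x
      rw [hp', eval_finsetSum, Finset.sum_mul_sum]
      refine Finset.sum_congr rfl fun j _ => Finset.sum_congr rfl fun i _ => ?_
      simp only [eval_mul, eval_C, eval_pow, eval_X]
      ring
    simp_rw [e]
    rw [intervalIntegral.integral_finsetSum
      (fun j _ => Continuous.intervalIntegrable (by fun_prop) _ _)]
    have e2 : ∀ j ∈ Finset.range (d + 1), (∫ x in (0 : ℝ)..1, ∑ i ∈ Finset.range (d + 1),
          (p.coeff j * c i) * x ^ (i + j)) = p.coeff j * (if j = 0 then 1 else 0) := by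
      intro j hj
      rw [intervalIntegral.integral_finsetSum
        (fun j _ => Continuous.intervalIntegrable (by fun_prop) _ _),
        ← hc j (by have := Finset.mem_range.mp hj; omega), Finset.mul_sum]
      refine Finset.sum_congr rfl fun i _ => ?_
      rw [intervalIntegral.integral_const_mul, integral_pow]
      push_cast
      simp
      ring
    rw [Finset.sum_congr rfl e2]
    simp [coeff_zero_eq_eval_zero]

open Polynomial in
theorem unit_endpoint (d : ℕ) (p : ℝ[X]) (hp : p.natDegree ≤ d) :
    (p.eval 0) ^ 2 ≤ ((d : ℝ) + 1) ^ 2 * ∫ x in (0 : ℝ)..1, (p.eval x) ^ 2 := by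
  obtain ⟨K, hK, hK0, hrep⟩ := exists_kernel d
  have h1 := hrep p hp
  have h2 := hrep K hK
  have key : 0 ≤ ∫ x in (0 : ℝ)..1, (((d : ℝ) + 1) ^ 2 * p.eval x - p.eval 0 * K.eval x) ^ 2 :=
    intervalIntegral.integral_nonneg (by norm_num) fun x _ => sq_nonneg _
  have e : ∀ x : ℝ, (((d : ℝ) + 1) ^ 2 * p.eval x - p.eval 0 * K.eval x) ^ 2 =
      ((d : ℝ) + 1) ^ 4 * (p.eval x) ^ 2 - 2 * ((d : ℝ) + 1) ^ 2 * p.eval 0 * (p.eval x * K.eval x)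
      + (p.eval 0) ^ 2 * (K.eval x * K.eval x) := fun x => by ring
  simp_rw [e] at key
  rw [intervalIntegral.integral_add (Continuous.intervalIntegrable (by fun_prop) _ _)
    (Continuous.intervalIntegrable (by fun_prop) _ _),
    intervalIntegral.integral_sub (Continuous.intervalIntegrable (by fun_prop) _ _)
    (Continuous.intervalIntegrable (by fun_prop) _ _),
    intervalIntegral.integral_const_mul, intervalIntegral.integral_const_mul,
    intervalIntegral.integral_const_mul, h1, h2, hK0] at key
  have hpos : (0 : ℝ) < ((d : ℝ) + 1) ^ 2 := by positivity
  refine le_of_mul_le_mul_left ?_ hpos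
  linarith

open Polynomial in
theorem shifted_endpoint (d : ℕ) (p : ℝ[X]) (hp : p.natDegree ≤ d) (t h : ℝ) :
    (p.eval t) ^ 2 ≤ ((d : ℝ) + 1) ^ 2 * ∫ x in (0 : ℝ)..1, (p.eval (h * x + t)) ^ 2 := by
  have hdeg : (p.comp (C h * X + C t)).natDegree ≤ d := by
    refine natDegree_comp_le.trans ?_
    calc _ ≤ d * 1 := Nat.mul_le_mul hp natDegree_linear_le
      _ = d := by ring
  simpa using unit_endpoint d _ hdeg

open Polynomial in
theorem pointwise_sq (d : ℕ) (a b : ℝ) (p : ℝ[X]) (hp : p.natDegree ≤ d) (t : ℝ)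
    (ht : t ∈ Set.Icc a b) :
    (b - a) * (p.eval t) ^ 2 ≤ ((d : ℝ) + 1) ^ 2 * ∫ x in a..b, (p.eval x) ^ 2 := by
  have hs : ∀ h : ℝ, h * ∫ x in (0 : ℝ)..1, (p.eval (h * x + t)) ^ 2 =
      ∫ x in t..(h + t), (p.eval x) ^ 2 := by
    intro h
    have := intervalIntegral.smul_integral_comp_mul_add (a := 0) (b := 1)
      (fun x => (p.eval x) ^ 2) h t
    simpa using this
  have h1 := mul_le_mul_of_nonneg_left (shifted_endpoint d p hp t (b - t)) (sub_nonneg.2 ht.2)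
  have h2 := mul_le_mul_of_nonneg_left (shifted_endpoint d p hp t (a - t)) (sub_nonneg.2 ht.1)
  have e1 := hs (b - t)
  have e2 := hs (a - t)
  rw [sub_add_cancel] at e1 e2
  rw [intervalIntegral.integral_symm a t] at e2
  have hadd : (∫ x in a..t, (p.eval x) ^ 2) + ∫ x in t..b, (p.eval x) ^ 2 =
      ∫ x in a..b, (p.eval x) ^ 2 :=
    intervalIntegral.integral_add_adjacent_intervals
      (Continuous.intervalIntegrable (by fun_prop) _ _)
      (Continuous.intervalIntegrable (by fun_prop) _ _)
  rw [← hadd]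
  linear_combination h1 + h2 + ((d : ℝ) + 1) ^ 2 * e1 - ((d : ℝ) + 1) ^ 2 * e2

/-- inverse inequality for polynomials on a general interval:
if `p` has degree at most `d` and `a < b`, then
`sup_{t∈[a,b]} |p(t)| ≤ ((d+1)/√(b−a))·(∫_a^b p(t)² dt)^{1/2}`. -/
theorem polynomial_sup_le_L2_interval
    (d : ℕ) (a b : ℝ) (hab : a < b)
    (p : Polynomial ℝ) (hdeg : p.natDegree ≤ d) :
    (⨆ t ∈ Set.Icc a b, |p.eval t|) ≤
      (d + 1) / Real.sqrt (b - a) * Real.sqrt (∫ t in a..b, (p.eval t) ^ 2) := by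
  have hR : 0 ≤ ((d : ℝ) + 1) / Real.sqrt (b - a) *
      Real.sqrt (∫ t in a..b, (p.eval t) ^ 2) := by positivity
  refine Real.iSup_le (fun t => Real.iSup_le (fun ht => ?_) hR) hR
  refine abs_le_of_sq_le_sq ?_ hR
  have hba : 0 < b - a := sub_pos.2 hab
  have hI : 0 ≤ ∫ t in a..b, (p.eval t) ^ 2 :=
    intervalIntegral.integral_nonneg hab.le fun x _ => sq_nonneg _
  rw [mul_pow, div_pow, Real.sq_sqrt hba.le, Real.sq_sqrt hI, div_mul_eq_mul_div, le_div_iff₀ hba,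
    mul_comm]
  exact pointwise_sq d a b p hdeg t ht
end

section
/- Let d ∈ ℕ, σ > 0, h > 0, and let t0 = a_0 < a_1 < … < a_K = tE be a partition of the interval Ω = (t0, tE) whose subintervals satisfy a_{k+1} − a_k ≥ σ·h for every k. Let v : Ω → ℝ be a function such that on each subinterval (a_k, a_{k+1}) the function v coincides with some polynomial of degree at most d. Then the essential supremum of |v| over Ω satisfies ess sup_{t ∈ Ω} |v(t)| ≤ ((d+1)/√(σ·h)) · (∫_{t0}^{tE} v(t)² dt)^{1/2}. -/
open MeasureTheory

open Polynomial in
lemma aux_parts (f g : ℝ[X]) :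
    ∫ x in (0:ℝ)..1, (derivative f).eval x * g.eval x =
      f.eval 1 * g.eval 1 - f.eval 0 * g.eval 0
        - ∫ x in (0:ℝ)..1, f.eval x * (derivative g).eval x := by
  have h := intervalIntegral.integral_mul_deriv_eq_deriv_mul (a := (0:ℝ)) (b := 1)
    (u := fun x => g.eval x) (v := fun x => f.eval x)
    (u' := fun x => (derivative g).eval x) (v' := fun x => (derivative f).eval x)
    (fun x _ => g.hasDerivAt x) (fun x _ => f.hasDerivAt x)
    ((derivative g).continuous.intervalIntegrable _ _)
    ((derivative f).continuous.intervalIntegrable _ _)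
  simp only [mul_comm (eval _ (derivative f)), mul_comm (eval _ f)]
  exact h

open Polynomial in
lemma aux_orth (w : ℝ[X]) (m : ℕ) : ∀ p : ℝ[X], p.natDegree < m →
    (∀ j < m, (derivative^[j] w).eval 0 = 0 ∧ (derivative^[j] w).eval 1 = 0) →
    ∫ x in (0:ℝ)..1, (derivative^[m] w).eval x * p.eval x = 0 := by
  induction m with
  | zero => intro p hp; omega
  | succ m ih =>
    intro p hp hw
    rw [Function.iterate_succ_apply', aux_parts, (hw m (by omega)).1, (hw m (by omega)).2]
    by_cases h0 : p.natDegree = 0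
    · have : derivative p = 0 := derivative_of_natDegree_zero h0
      simp [this]
    · rw [ih (derivative p) ?_ (fun j hj => hw j (by omega))]
      · simp
      · have := natDegree_derivative_lt h0
        omega

open Polynomial in
lemma aux_legendre (n : ℕ) : ∃ l : ℝ[X], l.natDegree ≤ n ∧ l.eval 0 = 1 ∧ l.eval 1 = (-1) ^ n ∧
    (derivative l).eval 0 = -(n * (n + 1)) ∧
    ∀ p : ℝ[X], p.natDegree < n → ∫ x in (0:ℝ)..1, l.eval x * p.eval x = 0 := by
  have e0 : aeval (0:ℝ) (shiftedLegendre n) = 1 := by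
    rw [← eval_map_algebraMap, ← coeff_zero_eq_eval_zero, coeff_map, coeff_shiftedLegendre]
    simp
  refine ⟨(shiftedLegendre n).map (algebraMap ℤ ℝ), ?_, ?_, ?_, ?_, ?_⟩
  · exact natDegree_map_le.trans (by simp)
  · rw [eval_map_algebraMap, e0]
  · rw [eval_map_algebraMap, shiftedLegendre_eval_symm, sub_self, e0, mul_one]
  · rw [← coeff_zero_eq_eval_zero, coeff_derivative, coeff_map, coeff_shiftedLegendre]
    simp [Nat.choose_succ_self_right]
  · intro p hp
    have hR : (n.factorial : ℝ[X]) * (shiftedLegendre n).map (algebraMap ℤ ℝ) =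
        derivative^[n] (X ^ n * (1 - (X : ℝ[X])) ^ n) := by
      have := congr_arg (Polynomial.map (algebraMap ℤ ℝ)) (factorial_mul_shiftedLegendre_eq n)
      rw [← iterate_derivative_map] at this
      simpa using this
    have key := aux_orth (X ^ n * (1 - (X : ℝ[X])) ^ n) n p hp ?_
    · rw [← hR] at key
      simp only [eval_mul, eval_natCast, mul_assoc] at key
      rw [intervalIntegral.integral_const_mul] at key
      exact (mul_eq_zero.1 key).resolve_left (by positivity)
    · intro j hj
      have h1 : (X : ℝ[X]) ∣ derivative^[j] (X ^ n * (1 - (X : ℝ[X])) ^ n) :=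
        (dvd_pow_self _ (by omega)).trans
          (pow_sub_dvd_iterate_derivative_of_pow_dvd j (Dvd.intro _ rfl))
      have h2 : (1 - X : ℝ[X]) ∣ derivative^[j] (X ^ n * (1 - (X : ℝ[X])) ^ n) :=
        (dvd_pow_self _ (by omega)).trans
          (pow_sub_dvd_iterate_derivative_of_pow_dvd j (Dvd.intro_left _ rfl))
      obtain ⟨r, hr⟩ := h1
      obtain ⟨s, hs⟩ := h2
      constructor
      · rw [hr]; simp
      · rw [hs]; simp

open Polynomial in
lemma aux_kernel (d : ℕ) : ∃ q : ℝ[X], q.natDegree ≤ d ∧ q.eval 0 = (d + 1) ^ 2 ∧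
    ∀ p : ℝ[X], p.natDegree ≤ d → ∫ x in (0:ℝ)..1, q.eval x * p.eval x = p.eval 0 := by
  have main : ∀ (n : ℕ) (l : ℝ[X]), l.eval 0 = 1 → l.eval 1 = (-1) ^ n →
      (∀ p : ℝ[X], p.natDegree < n → ∫ x in (0:ℝ)..1, l.eval x * p.eval x = 0) →
      ∀ p : ℝ[X], p.natDegree ≤ n →
      ∫ x in (0:ℝ)..1, (derivative l).eval x * p.eval x = (-1) ^ n * p.eval 1 - p.eval 0 := by
    intro n l h0 h1 ho p hp
    rw [aux_parts, h0, h1]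
    by_cases hz : p.natDegree = 0
    · have : derivative p = 0 := derivative_of_natDegree_zero hz
      simp [this]
    · rw [ho _ ((natDegree_derivative_lt hz).trans_le hp)]
      ring
  obtain ⟨l, ld, l0, l1, l', lo⟩ := aux_legendre d
  obtain ⟨k, kd, k0, k1, k', ko⟩ := aux_legendre (d + 1)
  refine ⟨C (-1/2) * (derivative l + derivative k), ?_, ?_, ?_⟩
  · refine (natDegree_C_mul_le _ _).trans (natDegree_add_le_of_degree_le ?_ ?_)
    · exact (natDegree_derivative_le l).trans (by omega)
    · exact (natDegree_derivative_le k).trans (by omega)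
  · simp only [eval_mul, eval_C, eval_add, l', k']
    push_cast
    ring
  · intro p hp
    have A := main d l l0 l1 lo p hp
    have B := main (d + 1) k k0 k1 ko p (by omega)
    simp only [eval_mul, eval_C, eval_add, mul_assoc, add_mul]
    rw [intervalIntegral.integral_const_mul, intervalIntegral.integral_add, A, B]
    · ring
    · exact ((derivative l).continuous.mul p.continuous).intervalIntegrable _ _
    · exact ((derivative k).continuous.mul p.continuous).intervalIntegrable _ _

open Polynomial in
lemma aux_endpoint (d : ℕ) (p : ℝ[X]) (hp : p.natDegree ≤ d) :
    (p.eval 0) ^ 2 ≤ (d + 1) ^ 2 * ∫ x in (0:ℝ)..1, (p.eval x) ^ 2 := by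
  obtain ⟨q, qd, q0, hq⟩ := aux_kernel d
  have hqq := hq q qd
  have hqp := hq p hp
  have hn : (0:ℝ) < (d + 1) ^ 2 := by positivity
  set c : ℝ := p.eval 0 / (d + 1) ^ 2 with hc
  have h0 : 0 ≤ ∫ x in (0:ℝ)..1, (p.eval x - c * q.eval x) ^ 2 :=
    intervalIntegral.integral_nonneg (by norm_num) (fun x _ => sq_nonneg _)
  have e : ∫ x in (0:ℝ)..1, (p.eval x - c * q.eval x) ^ 2 =
      (∫ x in (0:ℝ)..1, (p.eval x) ^ 2) - 2 * c * (p.eval 0) + c ^ 2 * (d + 1) ^ 2 := by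
    rw [← hqp, ← q0, ← hqq, ← intervalIntegral.integral_const_mul,
      ← intervalIntegral.integral_const_mul, ← intervalIntegral.integral_sub,
      ← intervalIntegral.integral_add]
    · congr 1; ext x; ring
    all_goals exact Continuous.intervalIntegrable (by fun_prop) _ _
  rw [e] at h0
  have h2 : c * (d + 1) ^ 2 = p.eval 0 := by rw [hc]; field_simp
  have h3 : c ^ 2 * (d + 1) ^ 2 = c * p.eval 0 := by rw [← h2]; ring
  have h4 : p.eval 0 ^ 2 = (d + 1) ^ 2 * (c * p.eval 0) := by rw [← h2]; ring
  rw [h4]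
  apply mul_le_mul_of_nonneg_left _ hn.le
  linarith

open Polynomial in
/-- The endpoint estimate on the interval between `t` and `s` (in either order). -/
lemma aux_scaled (d : ℕ) (p : ℝ[X]) (hp : p.natDegree ≤ d) (t s : ℝ) :
    (s - t) ^ 2 * (p.eval t) ^ 2 ≤ (d + 1) ^ 2 * ((s - t) * ∫ x in t..s, (p.eval x) ^ 2) := by
  have h := aux_endpoint d (p.comp (C t + C (s - t) * X)) (by
    refine natDegree_comp_le.trans ((Nat.mul_le_mul hp ?_).trans (by rw [mul_one]))
    compute_degree)
  have e := intervalIntegral.mul_integral_comp_add_mul (a := (0:ℝ)) (b := 1)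
    (f := fun x => (p.eval x) ^ 2) (s - t) t
  simp only [eval_comp, eval_add, eval_mul, eval_C, eval_X, mul_zero, add_zero] at h
  simp only [mul_zero, add_zero, mul_one, add_sub_cancel] at e
  rw [← e]
  nlinarith [mul_le_mul_of_nonneg_left h (sq_nonneg (s - t))]

open Polynomial in
lemma aux_interval (d : ℕ) (p : ℝ[X]) (hp : p.natDegree ≤ d) (a b t : ℝ)
    (h1 : a < t) (h2 : t < b) :
    (b - a) * (p.eval t) ^ 2 ≤ (d + 1) ^ 2 * ∫ x in a..b, (p.eval x) ^ 2 := by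
  have A := aux_scaled d p hp t a
  have B := aux_scaled d p hp t b
  rw [intervalIntegral.integral_symm] at A
  have A' : (t - a) * (p.eval t) ^ 2 ≤ (d + 1) ^ 2 * ∫ x in a..t, (p.eval x) ^ 2 := by
    refine le_of_mul_le_mul_left ?_ (sub_pos.2 h1)
    linarith
  have B' : (b - t) * (p.eval t) ^ 2 ≤ (d + 1) ^ 2 * ∫ x in t..b, (p.eval x) ^ 2 := by
    refine le_of_mul_le_mul_left ?_ (sub_pos.2 h2)
    linarith
  rw [← intervalIntegral.integral_add_adjacent_intervals (b := t)]
  · linarith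
  all_goals exact Continuous.intervalIntegrable (by fun_prop) _ _

lemma aux_cover (a : ℕ → ℝ) (t : ℝ) (hne : ∀ k, t ≠ a k) (h0 : a 0 < t) :
    ∀ K : ℕ, t < a K → ∃ k < K, t ∈ Set.Ioo (a k) (a (k + 1)) := by
  intro K
  induction K with
  | zero => intro h; linarith
  | succ K ih =>
    intro h
    rcases lt_or_gt_of_ne (hne K) with h' | h'
    · obtain ⟨k, hk, hk'⟩ := ih h'
      exact ⟨k, by omega, hk'⟩
    · exact ⟨K, by omega, h', h⟩

lemma aux_mono (a : ℕ → ℝ) (K : ℕ) (hmono : ∀ k < K, a k < a (k + 1)) :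
    ∀ k ≤ K, a 0 ≤ a k ∧ a k ≤ a K := by
  have h1 : ∀ k ≤ K, a 0 ≤ a k := by
    intro k
    induction k with
    | zero => simp
    | succ k ih => intro hk; exact (ih (by omega)).trans (hmono k (by omega)).le
  have h2 : ∀ j ≤ K, a (K - j) ≤ a K := by
    intro j
    induction j with
    | zero => simp
    | succ j ih =>
      intro hj
      have := hmono (K - (j + 1)) (by omega)
      rw [show K - (j + 1) + 1 = K - j by omega] at this
      exact this.le.trans (ih (by omega))
  intro k hk
  refine ⟨h1 k hk, ?_⟩
  have := h2 (K - k) (by omega)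
  rwa [show K - (K - k) = k by omega] at this

/-- equivalence of norms for piecewise polynomial functions
(Theorem `thm:EquivalenceOfNorms`).  Given a partition
`t0 = a 0 < a 1 < … < a K = tE` of `Ω = (t0, tE)` whose subintervals have
length at least `σ·h`, and a function `v` that coincides on each subinterval
with a polynomial of degree at most `d`, the essential supremum of `|v|`
satisfies `ess sup_Ω |v| ≤ ((d+1)/√(σh))·(∫_Ω v² )^{1/2}`. -/
theorem piecewise_polynomial_Linfty_le_L2
    (d : ℕ) (σ h : ℝ) (hσ : 0 < σ) (hh : 0 < h)
    (t0 tE : ℝ) (K : ℕ) (hK : 0 < K) (a : ℕ → ℝ)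
    (ha0 : a 0 = t0) (haK : a K = tE)
    (hmono : ∀ k < K, a k < a (k + 1))
    (hlen : ∀ k < K, σ * h ≤ a (k + 1) - a k)
    (v : ℝ → ℝ)
    (hpoly : ∀ k < K, ∃ p : Polynomial ℝ, p.natDegree ≤ d ∧
      ∀ t ∈ Set.Ioo (a k) (a (k + 1)), v t = p.eval t) :
    essSup (fun t => |v t|) (volume.restrict (Set.Ioo t0 tE)) ≤
      (d + 1) / Real.sqrt (σ * h) *
        Real.sqrt (∫ t in Set.Ioo t0 tE, (v t) ^ 2) := by
  subst ha0 haK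
  have hii : ∀ k < K, IntervalIntegrable (fun t => (v t) ^ 2) volume (a k) (a (k + 1)) := by
    intro k hk
    obtain ⟨p, -, hp⟩ := hpoly k hk
    rw [intervalIntegrable_iff_integrableOn_Ioo_of_le (hmono k hk).le]
    have hc : Continuous fun t => (p.eval t) ^ 2 := by fun_prop
    have : IntegrableOn (fun t => (p.eval t) ^ 2) (Set.Ioo (a k) (a (k + 1))) :=
      hc.integrableOn_Icc.mono_set Set.Ioo_subset_Icc_self
    refine this.congr_fun (fun t ht => ?_) measurableSet_Ioo
    simp only [hp t ht]
  have hm := aux_mono a K hmono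
  have hint : IntegrableOn (fun t => (v t) ^ 2) (Set.Ioo (a 0) (a K)) := by
    rw [← intervalIntegrable_iff_integrableOn_Ioo_of_le (hm K le_rfl).1]
    exact IntervalIntegrable.trans_iterate hii
  apply essSup_le_of_ae_le
  · have hne : ∀ᵐ t ∂(volume.restrict (Set.Ioo (a 0) (a K))), ∀ k, t ≠ a k := by
      rw [ae_all_iff]
      intro k
      exact Measure.ae_ne _ _
    filter_upwards [hne, ae_restrict_mem measurableSet_Ioo] with t hn ht
    obtain ⟨k, hk, htk⟩ := aux_cover a t hn ht.1 K ht.2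
    obtain ⟨p, hpd, hp⟩ := hpoly k hk
    have h1 := aux_interval d p hpd _ _ t htk.1 htk.2
    have e : ∫ x in (a k)..(a (k+1)), (p.eval x) ^ 2
        = ∫ x in Set.Ioo (a k) (a (k+1)), (v x) ^ 2 := by
      rw [intervalIntegral.integral_of_le (hmono k hk).le, integral_Ioc_eq_integral_Ioo]
      refine setIntegral_congr_fun measurableSet_Ioo (fun x hx => ?_)
      simp only [hp x hx]
    have h2 : ∫ x in Set.Ioo (a k) (a (k+1)), (v x) ^ 2
        ≤ ∫ x in Set.Ioo (a 0) (a K), (v x) ^ 2 := by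
      refine setIntegral_mono_set hint (Filter.Eventually.of_forall fun x => sq_nonneg _) ?_
      exact (Set.Ioo_subset_Ioo (hm k hk.le).1 (hm (k+1) hk).2).eventuallyLE
    rw [e] at h1
    have hs : 0 < σ * h := mul_pos hσ hh
    have h3 : (σ * h) * (v t) ^ 2 ≤ (d + 1) ^ 2 * ∫ x in Set.Ioo (a 0) (a K), (v x) ^ 2 := by
      rw [hp t htk]
      refine (mul_le_mul_of_nonneg_right (hlen k hk) (sq_nonneg _)).trans (h1.trans ?_)
      exact mul_le_mul_of_nonneg_left h2 (by positivity)
    have hI : 0 ≤ ∫ x in Set.Ioo (a 0) (a K), (v x) ^ 2 := integral_nonneg fun x => sq_nonneg _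
    show |v t| ≤ _
    refine abs_le_of_sq_le_sq ?_ (mul_nonneg (div_nonneg (by positivity) (Real.sqrt_nonneg _))
      (Real.sqrt_nonneg _))
    rw [mul_pow, div_pow, Real.sq_sqrt hs.le, Real.sq_sqrt hI, div_mul_eq_mul_div,
      le_div_iff₀ hs]
    linarith
  · have : (ae (volume.restrict (Set.Ioo (a 0) (a K)))).NeBot := by
      rw [ae_restrict_neBot, Real.volume_Ioo]
      have := (hmono 0 hK).trans_le (hm 1 hK).2
      simpa using this
    exact Filter.IsBoundedUnder.isCoboundedUnder_le
      (Filter.isBoundedUnder_of ⟨0, fun x => abs_nonneg (v x)⟩)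
end

section
/- Let V be a real Hilbert space, F : V → ℝ a functional, u⋆ ∈ V, and let δ > 0, c > 0, C > 0. Define the closed ball B := { v ∈ V : ‖u⋆ − v‖ ≤ δ }, and let V_h be a finite-dimensional linear subspace of V. Assume (i) for every v ∈ B ∩ V_h: F(u⋆) + c·‖u⋆ − v‖² ≤ F(v) ≤ F(u⋆) + C·‖v − u⋆‖, and (ii) inf_{v ∈ V_h} ‖u⋆ − v‖ ≤ δ. Then every minimizer u_h⋆ of F over B ∩ V_h (i.e. u_h⋆ ∈ B ∩ V_h with F(u_h⋆) ≤ F(v) for all v ∈ B ∩ V_h) satisfies ‖u⋆ − u_h⋆‖ ≤ √(C/c) · √(inf_{v ∈ V_h} ‖u⋆ − v‖). -/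
/-- general convergence result for discretized unconstrained
variational problems (Theorem `Thm:ConvergenceFEM`).
`V` a real Hilbert space, `u⋆ ∈ V`, `B` the closed `δ`-ball around `u⋆`,
`V_h` a finite-dimensional subspace.  If
(i) `F(u⋆) + c‖u⋆ − v‖² ≤ F(v) ≤ F(u⋆) + C‖v − u⋆‖` for all `v ∈ B ∩ V_h`, and
(ii) `inf_{v ∈ V_h} ‖u⋆ − v‖ ≤ δ`,
then every minimizer `u_h⋆` of `F` over `B ∩ V_h` satisfies
`‖u⋆ − u_h⋆‖ ≤ √(C/c)·√(inf_{v ∈ V_h} ‖u⋆ − v‖)`. -/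
theorem fem_convergence
    {V : Type*} [NormedAddCommGroup V] [InnerProductSpace ℝ V]
    [CompleteSpace V]
    (F : V → ℝ) (ustar : V)
    (δ c C : ℝ) (hδ : 0 < δ) (hc : 0 < c) (hC : 0 < C)
    (Vh : Submodule ℝ V) [FiniteDimensional ℝ Vh]
    (B : Set V) (hB : B = {v : V | ‖ustar - v‖ ≤ δ})
    (hi : ∀ v ∈ B, v ∈ Vh →
      F ustar + c * ‖ustar - v‖ ^ 2 ≤ F v ∧ F v ≤ F ustar + C * ‖v - ustar‖)
    (hii : (⨅ v : Vh, ‖ustar - (v : V)‖) ≤ δ)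
    (uh : V) (huhB : uh ∈ B) (huhVh : uh ∈ Vh)
    (huhmin : ∀ v ∈ B, v ∈ Vh → F uh ≤ F v) :
    ‖ustar - uh‖ ≤
      Real.sqrt (C / c) * Real.sqrt (⨅ v : Vh, ‖ustar - (v : V)‖) := by
  obtain ⟨w, hwV, hw⟩ := Submodule.exists_norm_eq_iInf_of_complete_subspace Vh
    (Submodule.complete_of_finiteDimensional Vh) ustar
  have hw' : ‖ustar - w‖ = ⨅ v : Vh, ‖ustar - (v : V)‖ := hw
  rw [← hw'] at hii ⊢
  have hwB : w ∈ B := by rw [hB]; exact hii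
  have h1 := (hi uh huhB huhVh).1
  have h2 := huhmin w hwB hwV
  have h3 := (hi w hwB hwV).2
  rw [norm_sub_rev w] at h3
  rw [← Real.sqrt_mul (by positivity)]
  apply Real.le_sqrt_of_sq_le
  rw [div_mul_eq_mul_div, le_div_iff₀ hc]
  linarith
end
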